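/- For positive integers k, l, p with k, l, p ≥ 2, and nonnegative integers m, n: ζ*(k, {p}^m) ζ*(l, {p}^n) = Σ_{1≤i≤m, 0≤j≤min(m-i,n), k∈A_j^{m+n-i-2j}} (-1)^j binom(m+n-i-2j, n-j) [ζ*(k, {p}^i, l, k) − ζ*(k, {p}^{i-1}, p+l, k)] + Σ_{1≤i≤n, 0≤j≤min(m,n-i), k∈A_j^{m+n-i-2j}} (-1)^j binom(m+n-i-2j, m-j) [ζ*(l, {p}^i, k, k) − ζ*(l, {p}^{i-1}, p+k, k)] + Σ_{0≤j≤min(m,n), k∈A_j^{m+n-2j}} (-1)^j binom(m+n-2j, m-j) [ζ*(k, l, k) + ζ*(l, k, k) − ζ*(k+l, k)]. -/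

import Mathlib

/-- The multiple zeta value ζ(k₁,…,kₙ) = ∑_{m₁ > m₂ > ⋯ > mₙ > 0} ∏ᵢ mᵢ^{-kᵢ}. -/
noncomputable def mzv (ks : List ℕ) : ℝ :=
  ∑' m : {f : Fin ks.length → ℕ // (∀ i j : Fin ks.length, i < j → f j < f i) ∧ ∀ i, 0 < f i},
    ∏ i : Fin ks.length, (1 : ℝ) / (m.1 i : ℝ) ^ ks.get i

/-- The multiple zeta-star value ζ*(k₁,…,kₙ) = ∑_{m₁ ≥ m₂ ≥ ⋯ ≥ mₙ ≥ 1} ∏ᵢ mᵢ^{-kᵢ}. -/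
noncomputable def mzvStar (ks : List ℕ) : ℝ :=
  ∑' m : {f : Fin ks.length → ℕ // (∀ i j : Fin ks.length, i < j → f j ≤ f i) ∧ ∀ i, 1 ≤ f i},
    ∏ i : Fin ks.length, (1 : ℝ) / (m.1 i : ℝ) ^ ks.get i

/-- The string consisting of copies of `p` and `2*p`, with `2*p` at the positions in `S`. -/
def strA {N : ℕ} (p : ℕ) (S : Finset (Fin N)) : List ℕ :=
  List.ofFn fun t => if t ∈ S then 2 * p else p

namespace MZS

noncomputable def I (k : ℕ) : (ℕ → ℝ) →ₗ[ℝ] (ℕ → ℝ) where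
  toFun f := fun N => ∑ a ∈ Finset.range N, (1 : ℝ) / ((a + 1 : ℕ) : ℝ) ^ k * f (a + 1)
  map_add' f g := by
    funext N
    simp [mul_add, Finset.sum_add_distrib]
  map_smul' c f := by
    funext N
    simp only [Pi.smul_apply, smul_eq_mul, RingHom.id_apply, Finset.mul_sum]
    exact Finset.sum_congr rfl fun a _ => by ring

theorem I_apply (k : ℕ) (f : ℕ → ℝ) (N : ℕ) :
    I k f N = ∑ a ∈ Finset.range N, (1 : ℝ) / ((a + 1 : ℕ) : ℝ) ^ k * f (a + 1) := rfl

theorem I_mul (k l : ℕ) (f g : ℕ → ℝ) :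
    I k f * I l g = I k (f * I l g) + I l (I k f * g) - I (k + l) (f * g) := by
  funext N
  simp only [Pi.mul_apply, Pi.add_apply, Pi.sub_apply]
  induction N with
  | zero => simp [I_apply]
  | succ N ih =>
    have h : ∀ k f, I k f (N + 1) = I k f N + (1 : ℝ) / ((N + 1 : ℕ) : ℝ) ^ k * f (N + 1) := by
      intro k f
      rw [I_apply, Finset.sum_range_succ, ← I_apply]
    rw [h k (f * I l g), h l (I k f * g), h (k + l)]
    simp only [Pi.mul_apply]
    rw [h k f, h l g, pow_add]
    have e : (1 : ℝ) / (((N + 1 : ℕ) : ℝ) ^ k * ((N + 1 : ℕ) : ℝ) ^ l)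
      = (1 / ((N + 1 : ℕ) : ℝ) ^ k) * (1 / ((N + 1 : ℕ) : ℝ) ^ l) := by
      rw [div_mul_div_comm, one_mul]
    rw [e]
    linear_combination ih

noncomputable def H : List ℕ → ℕ → ℝ
  | [] => 1
  | k :: w => I k (H w)

theorem H_cons (k w) : H (k :: w) = I k (H w) := rfl

theorem H_rep (p i w) : H (List.replicate i p ++ w) = ((I p)^[i]) (H w) := by
  induction i with
  | zero => rfl
  | succ i ih => rw [Function.iterate_succ_apply', ← ih]; rfl

/-- sum over strings -/
noncomputable def Q (p n j : ℕ) : ℕ → ℝ :=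
  ∑ S ∈ Finset.powersetCard j (Finset.univ : Finset (Fin n)), H (strA p S)

theorem strA_map {n : ℕ} (p : ℕ) (S : Finset (Fin n)) :
    strA p (S.map (Fin.succEmb n)) = p :: strA p S := by
  simp [strA, List.ofFn_succ]

theorem strA_insert {n : ℕ} (p : ℕ) (S : Finset (Fin n)) :
    strA p (insert 0 (S.map (Fin.succEmb n))) = (2 * p) :: strA p S := by
  simp [strA, List.ofFn_succ, Fin.succ_ne_zero]

theorem Q_zero (p : ℕ) : Q p 0 0 = 1 := by
  simp [Q, strA, H]

theorem Q_gt (p n j : ℕ) (h : n < j) : Q p n j = 0 := by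
  rw [Q, Finset.powersetCard_eq_empty.2 (by simpa using h), Finset.sum_empty]

theorem Q_succ_zero (p n : ℕ) : Q p (n + 1) 0 = I p (Q p n 0) := by
  have := strA_map p (∅ : Finset (Fin n))
  simp only [Finset.map_empty] at this
  simp [Q, this, H_cons]

theorem Q_succ_succ (p n j : ℕ) :
    Q p (n + 1) (j + 1) = I p (Q p n (j + 1)) + I (2 * p) (Q p n j) := by
  have h0 : (0 : Fin (n + 1)) ∉ (Finset.univ : Finset (Fin n)).map (Fin.succEmb n) := by
    simp [Fin.succ_ne_zero]
  have hu : (Finset.univ : Finset (Fin (n + 1)))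
      = insert 0 ((Finset.univ : Finset (Fin n)).map (Fin.succEmb n)) := by
    ext x
    refine Fin.cases ?_ (fun i => ?_) x <;> simp
  unfold Q
  rw [hu, Finset.powersetCard_succ_insert h0, Finset.sum_union, Finset.sum_image]
  · rw [Finset.powersetCard_map, Finset.powersetCard_map, Finset.sum_map, Finset.sum_map]
    simp only [map_sum]
    congr 1
    · refine Finset.sum_congr rfl fun S _ => ?_
      rw [← H_cons, ← strA_map]; rfl
    · refine Finset.sum_congr rfl fun S _ => ?_
      rw [← H_cons, ← strA_insert]; rfl
  · intro S hS T hT hST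
    have hS' : (0 : Fin (n + 1)) ∉ S := fun h => h0 ((Finset.mem_powersetCard.1 hS).1 h)
    have hT' : (0 : Fin (n + 1)) ∉ T := fun h => h0 ((Finset.mem_powersetCard.1 hT).1 h)
    rw [← Finset.erase_insert hS', ← Finset.erase_insert hT']
    exact congrArg (fun U => Finset.erase U 0) hST
  · rw [Finset.disjoint_left]
    intro S hS hS'
    obtain ⟨T, hT, rfl⟩ := Finset.mem_image.1 hS'
    exact h0 ((Finset.mem_powersetCard.1 hS).1 (Finset.mem_insert_self _ _))

def c (m n j : ℕ) : ℕ := if j ≤ m ∧ j ≤ n then Nat.choose (m + n - 2 * j) (m - j) else 0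

noncomputable def R (p m n K : ℕ) : ℕ → ℝ :=
  ∑ j ∈ Finset.range K, ((-1 : ℝ) ^ j * (c m n j : ℝ)) • Q p (m + n - j) j

theorem R_eq (p m n K : ℕ) (h : min m n < K) : R p m n K = R p m n (min m n + 1) := by
  unfold R
  symm
  apply Finset.sum_subset
  · intro x; simp; omega
  · intro x _ hx
    have : ¬ (x ≤ m ∧ x ≤ n) := by simp at hx; omega
    simp [c, this]

theorem c_succ (m n j : ℕ) : c (m + 1) (n + 1) (j + 1) = c m n j := by
  unfold c
  rw [show m + 1 + (n + 1) - 2 * (j + 1) = m + n - 2 * j by omega,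
    show m + 1 - (j + 1) = m - j by omega]
  simp

theorem c_pascal (p m n j : ℕ) :
    (c (m + 1) (n + 1) j : ℝ) • Q p (m + n + 1 - j) j
      = ((c m (n + 1) j : ℝ) + (c (m + 1) n j : ℝ)) • Q p (m + n + 1 - j) j := by
  by_cases hq : m + n + 1 - j < j
  · rw [Q_gt _ _ _ hq]; simp
  congr 1
  norm_cast
  unfold c
  by_cases h1 : j ≤ m
  · by_cases h2 : j ≤ n
    · rw [if_pos (by omega), if_pos (by omega), if_pos (by omega),
        show m + 1 + (n + 1) - 2 * j = (m + n + 1 - 2 * j) + 1 by omega,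
        show m + 1 - j = (m - j) + 1 by omega, Nat.choose_succ_succ,
        show m + (n + 1) - 2 * j = (m + n + 1 - 2 * j) by omega,
        show m + 1 + n - 2 * j = (m + n + 1 - 2 * j) by omega]
    · by_cases h3 : j = n + 1
      · subst h3
        rw [if_pos (by omega), if_pos (by omega), if_neg (by omega),
          show m + 1 + (n + 1) - 2 * (n + 1) = m + 1 - (n + 1) by omega,
          show m + (n + 1) - 2 * (n + 1) = m - (n + 1) by omega]
        simp
      · rw [if_neg (by omega), if_neg (by omega), if_neg (by omega)]
  · by_cases h3 : j = m + 1
    · subst h3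
      by_cases h2 : m + 1 ≤ n
      · rw [if_pos (by omega), if_neg (by omega), if_pos (by omega)]
        simp
      · rw [if_neg (by omega), if_neg (by omega), if_neg (by omega)]
    · rw [if_neg (by omega), if_neg (by omega), if_neg (by omega)]

theorem R_step (p m n K : ℕ) (hK : m + n + 2 ≤ K) :
    R p (m + 1) (n + 1) (K + 1) = I p (R p m (n + 1) (K + 1)) + I p (R p (m + 1) n (K + 1))
      - I (2 * p) (R p m n K) := by
  have e1 : R p m (n + 1) (K + 1) + R p (m + 1) n (K + 1)
      = ∑ j ∈ Finset.range (K + 1),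
        ((-1 : ℝ) ^ j * (c (m + 1) (n + 1) j : ℝ)) • Q p (m + n + 1 - j) j := by
    unfold R
    rw [← Finset.sum_add_distrib]
    refine Finset.sum_congr rfl fun j _ => ?_
    rw [mul_smul _ (c (m + 1) (n + 1) j : ℝ), c_pascal, ← mul_smul, mul_add, add_smul,
      show m + (n + 1) - j = m + n + 1 - j by omega, show m + 1 + n - j = m + n + 1 - j by omega]
  rw [← map_add, e1]
  unfold R
  rw [Finset.sum_range_succ', Finset.sum_range_succ' _ K]
  have e2 : Q p (m + 1 + (n + 1) - 0) 0 = I p (Q p (m + n + 1 - 0) 0) := by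
    rw [← Q_succ_zero]; congr 1; omega
  rw [e2]
  have e3 : ∀ j ∈ Finset.range K,
      ((-1 : ℝ) ^ (j + 1) * (c (m + 1) (n + 1) (j + 1) : ℝ)) • Q p (m + 1 + (n + 1) - (j + 1)) (j + 1)
      = ((-1 : ℝ) ^ (j + 1) * (c (m + 1) (n + 1) (j + 1) : ℝ)) • I p (Q p (m + n + 1 - (j + 1)) (j + 1))
        - ((-1 : ℝ) ^ j * (c m n j : ℝ)) • I (2 * p) (Q p (m + n - j) j) := by
    intro j _
    rw [c_succ]
    by_cases hj : j ≤ m ∧ j ≤ n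
    · rw [show m + 1 + (n + 1) - (j + 1) = (m + n - j) + 1 by omega,
        show m + n + 1 - (j + 1) = m + n - j by omega, Q_succ_succ, smul_add, pow_succ, sub_eq_add_neg,
        ← neg_smul]
      congr 2
      ring
    · simp [c, hj]
  rw [Finset.sum_congr rfl e3, Finset.sum_sub_distrib]
  simp only [map_add, map_sum, map_smul]
  abel

theorem H_rep_cons (p m) : H (List.replicate (m + 1) p) = I p (H (List.replicate m p)) := rfl

theorem Q_rep (p n : ℕ) : Q p n 0 = H (List.replicate n p) := by
  induction n with
  | zero => exact Q_zero p
  | succ n ih => rw [Q_succ_zero, ih]; rfl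

noncomputable def P (p m n : ℕ) : ℕ → ℝ := H (List.replicate m p) * H (List.replicate n p)

theorem P_comm (p m n : ℕ) : P p m n = P p n m := mul_comm _ _

theorem P_eq_R (p m n : ℕ) : P p m n = R p m n (min m n + 1) := by
  induction m generalizing n with
  | zero => simp [P, R, c, Q_rep, H]
  | succ m ihm =>
    induction n with
    | zero => simp [P, R, c, Q_rep, H]
    | succ n ihn =>
      rw [← R_eq p (m + 1) (n + 1) (m + n + 2 + 1) (by omega), R_step _ _ _ _ le_rfl,
        R_eq p m (n + 1) _ (by omega), R_eq p (m + 1) n _ (by omega), R_eq p m n _ (by omega),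
        ← ihm, ← ihn, ← ihm]
      unfold P
      rw [H_rep_cons, H_rep_cons, I_mul, two_mul]

/-- explicit form -/
theorem P_eq (p m n : ℕ) : P p m n = ∑ j ∈ Finset.range (min m n + 1),
    ∑ S ∈ Finset.powersetCard j (Finset.univ : Finset (Fin (m + n - 2 * j + j))),
      ((-1 : ℝ) ^ j * (Nat.choose (m + n - 2 * j) (m - j) : ℝ)) • H (strA p S) := by
  rw [P_eq_R, R]
  refine Finset.sum_congr rfl fun j hj => ?_
  have hj' : j ≤ m ∧ j ≤ n := by simp at hj; omega
  rw [← Finset.smul_sum, c, if_pos hj', ← Q, show m + n - 2 * j + j = m + n - j by omega]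

theorem G_eq (p l m n : ℕ) (g : ℕ → ℝ) (hg : g = H (List.replicate n p)) :
    H (List.replicate m p) * I l g = I l (P p m n) + ∑ i ∈ Finset.range m,
      ((I p)^[i + 1] (I l (P p (m - (i + 1)) n)) - (I p)^[i] (I (p + l) (P p (m - (i + 1)) n))) := by
  induction m with
  | zero => simp [H, P, hg]
  | succ m ih =>
    rw [H_rep_cons, I_mul, ih, Finset.sum_range_succ', map_add, map_sum, ← H_rep_cons]
    simp only [map_sub, ← Function.iterate_succ_apply' (I p)]
    subst hg
    simp only [P, Nat.add_sub_add_right, zero_add, Nat.sub_zero, Function.iterate_zero, id,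
      Function.iterate_one, Nat.add_sub_cancel]
    abel

theorem sum_Icc_range {M : Type*} [AddCommMonoid M] (f : ℕ → M) (m : ℕ) :
    ∑ i ∈ Finset.Icc 1 m, f i = ∑ i ∈ Finset.range m, f (i + 1) := by
  induction m with
  | zero => simp
  | succ m ih => rw [Finset.sum_Icc_succ_top (by omega), ih, Finset.sum_range_succ]

theorem iter_sum {ι : Type*} (p i : ℕ) (s : Finset ι) (f : ι → ℕ → ℝ) :
    (I p)^[i] (∑ x ∈ s, f x) = ∑ x ∈ s, (I p)^[i] (f x) := by
  rw [← Module.End.coe_pow, map_sum]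

theorem iter_smul (p i : ℕ) (r : ℝ) (f : ℕ → ℝ) :
    (I p)^[i] (r • f) = r • (I p)^[i] f := by
  rw [← Module.End.coe_pow, map_smul]

theorem half (k l p m n : ℕ) :
    I k (H (List.replicate m p) * I l (H (List.replicate n p))) = I k (I l (P p m n)) +
      ∑ i ∈ Finset.Icc 1 m, ∑ j ∈ Finset.range (min (m - i) n + 1),
        ∑ S ∈ Finset.powersetCard j (Finset.univ : Finset (Fin (m + n - i - 2 * j + j))),
          ((-1 : ℝ) ^ j * (Nat.choose (m + n - i - 2 * j) (n - j) : ℝ)) •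
            (H (k :: (List.replicate i p ++ l :: strA p S))
              - H (k :: (List.replicate (i - 1) p ++ (p + l) :: strA p S))) := by
  rw [G_eq p l m n _ rfl, map_add, map_sum, sum_Icc_range]
  congr 1
  refine Finset.sum_congr rfl fun i hi => ?_
  have hi' : i < m := by simpa using hi
  rw [P_eq]
  simp only [map_sum, iter_sum, map_smul, iter_smul, H_cons, H_rep, smul_sub, map_sub,
    Finset.sum_sub_distrib, Nat.add_sub_cancel]
  have e : m - (i + 1) + n = m + n - (i + 1) := by omega
  rw [e]
  have key : ∀ j ∈ Finset.range (min (m - (i + 1)) n + 1),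
      (m + n - (i + 1) - 2 * j).choose (m - (i + 1) - j)
        = (m + n - (i + 1) - 2 * j).choose (n - j) := by
    intro j hj
    simp at hj
    apply Nat.choose_symm_of_eq_add
    omega
  congr 1 <;> exact Finset.sum_congr rfl fun j hj => by rw [key j hj]

theorem finite_id (k l p m n : ℕ) :
    H (k :: List.replicate m p) * H (l :: List.replicate n p) =
      (∑ i ∈ Finset.Icc 1 m, ∑ j ∈ Finset.range (min (m - i) n + 1),
        ∑ S ∈ Finset.powersetCard j (Finset.univ : Finset (Fin (m + n - i - 2 * j + j))),
          ((-1 : ℝ) ^ j * (Nat.choose (m + n - i - 2 * j) (n - j) : ℝ)) •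
            (H (k :: (List.replicate i p ++ l :: strA p S))
              - H (k :: (List.replicate (i - 1) p ++ (p + l) :: strA p S))))
      + (∑ i ∈ Finset.Icc 1 n, ∑ j ∈ Finset.range (min m (n - i) + 1),
        ∑ S ∈ Finset.powersetCard j (Finset.univ : Finset (Fin (m + n - i - 2 * j + j))),
          ((-1 : ℝ) ^ j * (Nat.choose (m + n - i - 2 * j) (m - j) : ℝ)) •
            (H (l :: (List.replicate i p ++ k :: strA p S))
              - H (l :: (List.replicate (i - 1) p ++ (p + k) :: strA p S))))
      + (∑ j ∈ Finset.range (min m n + 1),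
        ∑ S ∈ Finset.powersetCard j (Finset.univ : Finset (Fin (m + n - 2 * j + j))),
          ((-1 : ℝ) ^ j * (Nat.choose (m + n - 2 * j) (m - j) : ℝ)) •
            (H (k :: l :: strA p S) + H (l :: k :: strA p S)
              - H ((k + l) :: strA p S))) := by
  have h3 : (∑ j ∈ Finset.range (min m n + 1),
        ∑ S ∈ Finset.powersetCard j (Finset.univ : Finset (Fin (m + n - 2 * j + j))),
          ((-1 : ℝ) ^ j * (Nat.choose (m + n - 2 * j) (m - j) : ℝ)) •
            (H (k :: l :: strA p S) + H (l :: k :: strA p S)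
              - H ((k + l) :: strA p S)))
      = I k (I l (P p m n)) + I l (I k (P p m n)) - I (k + l) (P p m n) := by
    rw [P_eq]
    simp only [map_sum, map_smul, H_cons, smul_sub, smul_add, Finset.sum_sub_distrib,
      Finset.sum_add_distrib]
  have h2 := half l k p n m
  rw [P_comm p n m, Nat.add_comm n m] at h2
  simp only [min_comm (n - _) m] at h2
  rw [h3, H_cons, H_cons, I_mul, half, mul_comm (I k _) (H _), h2]
  change _ + _ - I (k + l) (P p m n) = _
  have ab : ∀ a b c s t : ℕ → ℝ, (a + s) + (b + t) - c = s + t + (a + b - c) := by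
    intros; abel
  exact ab _ _ _ _ _

/-! limits -/

def L : (n : ℕ) → ℕ → Finset (Fin n → ℕ)
  | 0, _ => {Fin.elim0}
  | n + 1, N => (Finset.range N).biUnion fun a => (L n (a + 1)).image (Fin.cons (α := fun _ => ℕ) (a + 1))

theorem mem_L (n N : ℕ) (f : Fin n → ℕ) : f ∈ L n N ↔
    ((∀ i j : Fin n, i < j → f j ≤ f i) ∧ ∀ i, 1 ≤ f i) ∧ ∀ i, f i ≤ N := by
  induction n generalizing N with
  | zero => simp [L]; exact Subsingleton.elim _ _
  | succ n ih =>
    simp only [L, Finset.mem_biUnion, Finset.mem_image, Finset.mem_range]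
    constructor
    · rintro ⟨a, ha, g, hg, rfl⟩
      obtain ⟨⟨h1, h2⟩, h3⟩ := (ih _ _).1 hg
      refine ⟨⟨fun i j => ?_, fun i => ?_⟩, fun i => ?_⟩
      · refine Fin.cases (fun h => absurd h (Fin.not_lt_zero _)) (fun j => ?_) j
        refine Fin.cases (fun _ => ?_) (fun i h => ?_) i
        · simpa using h3 j
        · simpa using h1 i j (Fin.succ_lt_succ_iff.1 h)
      · refine Fin.cases ?_ (fun i => ?_) i
        · simp
        · simpa using h2 i
      · refine Fin.cases ?_ (fun i => ?_) i
        · simpa using ha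
        · simpa using (h3 i).trans ha
    · rintro ⟨⟨h1, h2⟩, h3⟩
      have h0 := h2 0
      have h0' := h3 0
      refine ⟨f 0 - 1, by omega, Fin.tail f, (ih _ _).2 ⟨⟨fun i j h => ?_, fun i => h2 _⟩, fun i => ?_⟩, ?_⟩
      · exact h1 _ _ (Fin.succ_lt_succ_iff.2 h)
      · rw [Nat.sub_add_cancel h0]
        exact h1 0 i.succ (Fin.succ_pos i)
      · rw [Nat.sub_add_cancel h0]
        exact Fin.cons_self_tail f

noncomputable def term (ks : List ℕ) (f : Fin ks.length → ℕ) : ℝ :=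
  ∏ i : Fin ks.length, (1 : ℝ) / (f i : ℝ) ^ ks.get i

theorem sum_L (ks : List ℕ) (N : ℕ) : ∑ f ∈ L ks.length N, term ks f = H ks N := by
  induction ks generalizing N with
  | nil => simp [L, H, term]
  | cons k w ih =>
    change ∑ f ∈ L (w.length + 1) N, term (k :: w) f = _
    rw [L, Finset.sum_biUnion, H_cons, I_apply]
    · refine Finset.sum_congr rfl fun a _ => ?_
      rw [Finset.sum_image, ← ih, Finset.mul_sum]
      · refine Finset.sum_congr rfl fun g _ => ?_
        exact Fin.prod_univ_succ (n := w.length) _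
      · intro x _ y _ h
        exact (Fin.cons_injective2 h).2
    · intro a _ b _ hab
      rw [Function.onFun, Finset.disjoint_left]
      intro f hf hf'
      obtain ⟨g, _, rfl⟩ := Finset.mem_image.1 hf
      obtain ⟨g', _, h⟩ := Finset.mem_image.1 hf'
      have := (Fin.cons_injective2 h).1
      omega

theorem H_nonneg (ks : List ℕ) (N : ℕ) : 0 ≤ H ks N := by
  rw [← sum_L]
  exact Finset.sum_nonneg fun f _ => Finset.prod_nonneg fun i _ => by positivity

theorem H_bdd (ks : List ℕ) (h : ∀ k ∈ ks, 2 ≤ k) : ∃ C, ∀ N, H ks N ≤ C := by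
  induction ks with
  | nil => exact ⟨1, fun N => le_rfl⟩
  | cons k w ih =>
    obtain ⟨C, hC⟩ := ih fun x hx => h x (List.mem_cons_of_mem _ hx)
    have hs : Summable fun a : ℕ => (1 : ℝ) / ((a + 1 : ℕ) : ℝ) ^ k :=
      (summable_nat_add_iff 1).2 (Real.summable_one_div_nat_pow.2 (h k List.mem_cons_self))
    refine ⟨(∑' a : ℕ, (1 : ℝ) / ((a + 1 : ℕ) : ℝ) ^ k) * C, fun N => ?_⟩
    have hC0 : 0 ≤ C := (H_nonneg w 0).trans (hC 0)
    rw [H_cons, I_apply]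
    calc _ ≤ ∑ a ∈ Finset.range N, (1 : ℝ) / ((a + 1 : ℕ) : ℝ) ^ k * C :=
          Finset.sum_le_sum fun a _ => mul_le_mul_of_nonneg_left (hC _) (by positivity)
      _ = (∑ a ∈ Finset.range N, (1 : ℝ) / ((a + 1 : ℕ) : ℝ) ^ k) * C := by rw [Finset.sum_mul]
      _ ≤ _ := mul_le_mul_of_nonneg_right
          (hs.sum_le_tsum _ fun a _ => by positivity) hC0

theorem tendsto_H (ks : List ℕ) (h : ∀ k ∈ ks, 2 ≤ k) :
    Filter.Tendsto (H ks) Filter.atTop (nhds (mzvStar ks)) := by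
  classical
  set s : Set (Fin ks.length → ℕ) :=
    {f | (∀ i j : Fin ks.length, i < j → f j ≤ f i) ∧ ∀ i, 1 ≤ f i} with hs
  let LL : ℕ → Finset s := fun N => (L ks.length N).subtype (· ∈ s)
  have hsum : ∀ N, ∑ f ∈ LL N, term ks f.1 = H ks N := by
    intro N
    rw [← sum_L, Finset.sum_subtype_of_mem (f := term ks)]
    intro f hf
    exact ((mem_L _ _ _).1 hf).1
  have hmono : Monotone LL := by
    intro a b hab f hf
    rw [Finset.mem_subtype, mem_L] at hf ⊢
    exact ⟨hf.1, fun i => (hf.2 i).trans hab⟩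
  have hex : ∀ f : s, ∃ N, f ∈ LL N := by
    intro f
    refine ⟨∑ i, f.1 i, ?_⟩
    rw [Finset.mem_subtype, mem_L]
    exact ⟨f.2, fun i => Finset.single_le_sum (f := f.1) (fun _ _ => Nat.zero_le _) (Finset.mem_univ i)⟩
  have hT : Filter.Tendsto LL Filter.atTop Filter.atTop :=
    Filter.tendsto_atTop_finset_of_monotone hmono hex
  have hnn : ∀ f : s, 0 ≤ term ks f.1 := fun f => Finset.prod_nonneg fun i _ => by positivity
  obtain ⟨C, hC⟩ := H_bdd ks h
  have hsm : Summable fun f : s => term ks f.1 := by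
    refine summable_of_sum_le hnn (c := C) fun u => ?_
    obtain ⟨N, hN⟩ := (hT.eventually (Filter.eventually_ge_atTop u)).exists
    refine (Finset.sum_le_sum_of_subset_of_nonneg hN fun f _ _ => hnn f).trans ?_
    rw [hsum]; exact hC N
  have := hsm.hasSum.comp hT
  refine Filter.Tendsto.congr hsum this

theorem strA_ge {N : ℕ} (p : ℕ) (hp : 2 ≤ p) (S : Finset (Fin N)) : ∀ x ∈ strA p S, 2 ≤ x := by
  intro x hx
  obtain ⟨t, rfl⟩ := (List.mem_ofFn' _ _).1 hx
  dsimp only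
  split_ifs <;> omega

end MZS

theorem mzvStar_stuffle_one_one (k l p : ℕ) (hk : 2 ≤ k) (hl : 2 ≤ l) (hp : 2 ≤ p) (m n : ℕ) :
    mzvStar (k :: List.replicate m p) * mzvStar (l :: List.replicate n p) =
      (∑ i ∈ Finset.Icc 1 m, ∑ j ∈ Finset.range (min (m - i) n + 1),
        ∑ S ∈ Finset.powersetCard j (Finset.univ : Finset (Fin (m + n - i - 2 * j + j))),
          (-1 : ℝ) ^ j * (Nat.choose (m + n - i - 2 * j) (n - j) : ℝ) *
            (mzvStar (k :: (List.replicate i p ++ l :: strA p S))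
              - mzvStar (k :: (List.replicate (i - 1) p ++ (p + l) :: strA p S))))
      + (∑ i ∈ Finset.Icc 1 n, ∑ j ∈ Finset.range (min m (n - i) + 1),
        ∑ S ∈ Finset.powersetCard j (Finset.univ : Finset (Fin (m + n - i - 2 * j + j))),
          (-1 : ℝ) ^ j * (Nat.choose (m + n - i - 2 * j) (m - j) : ℝ) *
            (mzvStar (l :: (List.replicate i p ++ k :: strA p S))
              - mzvStar (l :: (List.replicate (i - 1) p ++ (p + k) :: strA p S))))
      + (∑ j ∈ Finset.range (min m n + 1),
        ∑ S ∈ Finset.powersetCard j (Finset.univ : Finset (Fin (m + n - 2 * j + j))),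
          (-1 : ℝ) ^ j * (Nat.choose (m + n - 2 * j) (m - j) : ℝ) *
            (mzvStar (k :: l :: strA p S) + mzvStar (l :: k :: strA p S)
              - mzvStar ((k + l) :: strA p S))) := by
  open MZS in
  have T1 : ∀ (a b i : ℕ), 2 ≤ a → 2 ≤ b → ∀ {N : ℕ} (S : Finset (Fin N)),
      Filter.Tendsto (H (a :: (List.replicate i p ++ b :: strA p S))) Filter.atTop
        (nhds (mzvStar (a :: (List.replicate i p ++ b :: strA p S)))) := by
    intro a b i ha hb N S
    apply tendsto_H
    intro x hx
    simp only [List.mem_cons, List.mem_append, List.mem_replicate] at hx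
    rcases hx with rfl | ⟨_, rfl⟩ | rfl | hx
    · exact ha
    · exact hp
    · exact hb
    · exact strA_ge p hp S x hx
  have T2 : ∀ (a : ℕ), 2 ≤ a → ∀ {N : ℕ} (S : Finset (Fin N)),
      Filter.Tendsto (MZS.H (a :: strA p S)) Filter.atTop (nhds (mzvStar (a :: strA p S))) := by
    intro a ha N S
    apply MZS.tendsto_H
    intro x hx
    rcases List.mem_cons.1 hx with rfl | hx
    · exact ha
    · exact MZS.strA_ge p hp S x hx
  have T3 : ∀ (a i : ℕ), 2 ≤ a →
      Filter.Tendsto (MZS.H (a :: List.replicate i p)) Filter.atTop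
        (nhds (mzvStar (a :: List.replicate i p))) := by
    intro a i ha
    apply MZS.tendsto_H
    intro x hx
    simp only [List.mem_cons, List.mem_replicate] at hx
    rcases hx with rfl | ⟨_, rfl⟩
    · exact ha
    · exact hp
  have hL := (T3 k m hk).mul (T3 l n hl)
  have hid : (fun N => MZS.H (k :: List.replicate m p) N * MZS.H (l :: List.replicate n p) N) = _ :=
    MZS.finite_id k l p m n
  rw [hid] at hL
  refine tendsto_nhds_unique hL ?_
  refine Filter.Tendsto.add (Filter.Tendsto.add ?_ ?_) ?_
  · rw [Finset.sum_fn]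
    refine tendsto_finsetSum _ fun i _ => ?_
    rw [Finset.sum_fn]
    refine tendsto_finsetSum _ fun j _ => ?_
    rw [Finset.sum_fn]
    refine tendsto_finsetSum _ fun S _ => ?_
    exact ((T1 k l i hk hl S).sub (T1 k (p + l) (i - 1) hk (by omega) S)).const_mul _
  · rw [Finset.sum_fn]
    refine tendsto_finsetSum _ fun i _ => ?_
    rw [Finset.sum_fn]
    refine tendsto_finsetSum _ fun j _ => ?_
    rw [Finset.sum_fn]
    refine tendsto_finsetSum _ fun S _ => ?_
    exact ((T1 l k i hl hk S).sub (T1 l (p + k) (i - 1) hl (by omega) S)).const_mul _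
  · rw [Finset.sum_fn]
    refine tendsto_finsetSum _ fun j _ => ?_
    rw [Finset.sum_fn]
    refine tendsto_finsetSum _ fun S _ => ?_
    exact (((T1 k l 0 hk hl S).add (T1 l k 0 hl hk S)).sub (T2 (k + l) (by omega) S)).const_mul _
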